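/- Let u be a nonzero vector in Euclidean space ℝⁿ and let V, W be linear subspaces of ℝⁿ with V ≠ {0} and W ≠ {0}. Then θ(u, W) ≤ θ(u, V) + θ(V, W). -/

import Mathlib

open InnerProductGeometry

/-- The angle between a vector `u` and a linear subspace `V`:
`θ(u,V) := inf{θ(u,v) : v ∈ V, v ≠ 0}`. -/
noncomputable def angleToSub {n : ℕ} (u : EuclideanSpace ℝ (Fin n))
    (V : Submodule ℝ (EuclideanSpace ℝ (Fin n))) : ℝ :=
  sInf {θ : ℝ | ∃ v ∈ V, v ≠ 0 ∧ θ = InnerProductGeometry.angle u v}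

/-- The (one-sided) angle between linear subspaces `U` and `V`:
`θ(U,V) := sup{θ(u,V) : u ∈ U, u ≠ 0}`. -/
noncomputable def subAngle {n : ℕ} (U V : Submodule ℝ (EuclideanSpace ℝ (Fin n))) : ℝ :=
  sSup {θ : ℝ | ∃ u ∈ U, u ≠ 0 ∧ θ = angleToSub u V}

lemma angleToSub_le_angle {n : ℕ} (u : EuclideanSpace ℝ (Fin n))
    {V : Submodule ℝ (EuclideanSpace ℝ (Fin n))} {v : EuclideanSpace ℝ (Fin n)}
    (hv : v ∈ V) (hv0 : v ≠ 0) : angleToSub u V ≤ angle u v := by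
  refine csInf_le ⟨0, ?_⟩ ⟨v, hv, hv0, rfl⟩
  rintro _ ⟨w, -, -, rfl⟩
  exact angle_nonneg u w

lemma le_angleToSub {n : ℕ} {u : EuclideanSpace ℝ (Fin n)}
    {V : Submodule ℝ (EuclideanSpace ℝ (Fin n))} (hV : V ≠ ⊥) {a : ℝ}
    (h : ∀ v ∈ V, v ≠ 0 → a ≤ angle u v) : a ≤ angleToSub u V := by
  obtain ⟨v, hv, hv0⟩ := V.exists_mem_ne_zero_of_ne_bot hV
  refine le_csInf ⟨_, v, hv, hv0, rfl⟩ ?_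
  rintro _ ⟨w, hw, hw0, rfl⟩
  exact h w hw hw0

lemma angleToSub_le_subAngle {n : ℕ} {V W : Submodule ℝ (EuclideanSpace ℝ (Fin n))}
    (hW : W ≠ ⊥) {v : EuclideanSpace ℝ (Fin n)} (hv : v ∈ V) (hv0 : v ≠ 0) :
    angleToSub v W ≤ subAngle V W := by
  obtain ⟨w, hw, hw0⟩ := W.exists_mem_ne_zero_of_ne_bot hW
  refine le_csSup ⟨Real.pi, ?_⟩ ⟨v, hv, hv0, rfl⟩
  rintro _ ⟨x, -, -, rfl⟩
  exact (angleToSub_le_angle x hw hw0).trans (angle_le_pi x w)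

lemma angleToSub_le_angle_add_angleToSub {n : ℕ} (u v : EuclideanSpace ℝ (Fin n))
    {W : Submodule ℝ (EuclideanSpace ℝ (Fin n))} (hW : W ≠ ⊥) :
    angleToSub u W ≤ angle u v + angleToSub v W := by
  rw [← sub_le_iff_le_add']
  refine le_angleToSub hW fun w hw hw0 => ?_
  rw [sub_le_iff_le_add']
  exact (angleToSub_le_angle u hw hw0).trans (angle_le_angle_add_angle u v w)

/-- Triangle inequality for the angle from a vector to subspaces:
`θ(u, W) ≤ θ(u, V) + θ(V, W)` for `u ≠ 0` and nonzero subspaces `V, W`. -/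
theorem vector_subspace_angle_triangle {n : ℕ} (u : EuclideanSpace ℝ (Fin n)) (hu : u ≠ 0)
    (V W : Submodule ℝ (EuclideanSpace ℝ (Fin n))) (hV : V ≠ ⊥) (hW : W ≠ ⊥) :
    angleToSub u W ≤ angleToSub u V + subAngle V W := by
  rw [← sub_le_iff_le_add]
  refine le_angleToSub hV fun v hv hv0 => ?_
  rw [sub_le_iff_le_add]
  exact (angleToSub_le_angle_add_angleToSub u v hW).trans
    (by gcongr; exact angleToSub_le_subAngle hW hv hv0)
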